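/- arXiv:2603.06430 — 4 statements merged into one kernel-verified Lean document; each statement's English description precedes it below -/
import Mathlib

section
/- Let S = (S_x | x ∈ D) be a family of semiintervals of a linear order (D,<). Then for every n ≥ 1, the family of n-th powers (S_x^n | x ∈ D) is again a family of semiintervals of (D,<): each S_x^n is convex with minimum element x. Moreover, if S is monotone, then (S_x^n | x ∈ D) is monotone. -/
namespace SemiIntervalFamilies

/-- The `n`-th power of a family of semiintervals, indexed so that `famPow S 1 x = S x`
and `famPow S (n+1) x = ⋃ t ∈ famPow S n x, S t`. -/
def famPow {D : Type*} (S : D → Set D) : ℕ → D → Set D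
  | 0, x => {x}
  | n + 1, x => ⋃ t ∈ famPow S n x, S t

/-- `S` is a family of semiintervals of the linear order `D`: each `S x` is convex
and has minimum element `x`. -/
def IsSemiIntervalFamily {D : Type*} [LinearOrder D] (S : D → Set D) : Prop :=
  ∀ x : D, (∀ a ∈ S x, ∀ b ∈ S x, ∀ c : D, a ≤ c → c ≤ b → c ∈ S x) ∧
    x ∈ S x ∧ (∀ y ∈ S x, x ≤ y)

/-- The smallest initial part of `D` containing `X`. -/
def supin {D : Type*} [LinearOrder D] (X : Set D) : Set D :=
  {d : D | ∃ x ∈ X, d ≤ x}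

/-- The family `S` is monotone if `x ≤ y` implies `supin (S x) ⊆ supin (S y)`. -/
def IsMonotoneFamily {D : Type*} [LinearOrder D] (S : D → Set D) : Prop :=
  ∀ x y : D, x ≤ y → supin (S x) ⊆ supin (S y)

/-- `S a` is a shift: the sequence of powers `(S_a^n)_{n ≥ 1}` is strictly
increasing under inclusion. -/
def IsShift {D : Type*} (S : D → Set D) (a : D) : Prop :=
  ∀ n : ℕ, 1 ≤ n → famPow S n a ⊂ famPow S (n + 1) a

/-- The convex hull of a subset of a linear order. -/
def conv {D : Type*} [LinearOrder D] (X : Set D) : Set D :=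
  {d : D | ∃ a ∈ X, ∃ b ∈ X, a ≤ d ∧ d ≤ b}

end SemiIntervalFamilies

open SemiIntervalFamilies

namespace SemiIntervalFamilies

theorem IsSemiIntervalFamily.famPow {D : Type*} [LinearOrder D] {S : D → Set D}
    (hS : IsSemiIntervalFamily S) (n : ℕ) : IsSemiIntervalFamily (famPow S n) := by
  induction n with
  | zero =>
    intro x
    refine ⟨?_, rfl, fun y hy => (Set.mem_singleton_iff.1 hy).ge⟩
    rintro a rfl b rfl c hac hcb
    exact le_antisymm hcb hac
  | succ n ih =>
    intro x
    obtain ⟨hconv, hmem, hmin⟩ := ih x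
    refine ⟨?_, Set.mem_iUnion₂.2 ⟨x, hmem, (hS x).2.1⟩, ?_⟩
    · intro a ha b hb c hac hcb
      obtain ⟨s, hs, has⟩ := Set.mem_iUnion₂.1 ha
      obtain ⟨t, ht, hbt⟩ := Set.mem_iUnion₂.1 hb
      rcases le_total c t with hct | htc
      · exact Set.mem_iUnion₂.2
          ⟨c, hconv s hs t ht c (((hS s).2.2 a has).trans hac) hct, (hS c).2.1⟩
      · exact Set.mem_iUnion₂.2 ⟨t, ht, (hS t).1 t (hS t).2.1 b hbt c htc hcb⟩
    · intro y hy
      obtain ⟨t, ht, hyt⟩ := Set.mem_iUnion₂.1 hy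
      exact (hmin t ht).trans ((hS t).2.2 y hyt)

theorem IsMonotoneFamily.famPow {D : Type*} [LinearOrder D] {S : D → Set D}
    (hS : IsMonotoneFamily S) (n : ℕ) : IsMonotoneFamily (famPow S n) := by
  induction n with
  | zero =>
    rintro x y hxy d ⟨z, rfl, hdz⟩
    exact ⟨y, rfl, hdz.trans hxy⟩
  | succ n ih =>
    rintro x y hxy d ⟨z, hz, hdz⟩
    obtain ⟨t, ht, hzt⟩ := Set.mem_iUnion₂.1 hz
    obtain ⟨t', ht', htt'⟩ := ih x y hxy ⟨t, ht, le_rfl⟩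
    obtain ⟨w, hw, hdw⟩ := hS t t' htt' ⟨z, hzt, hdz⟩
    exact ⟨w, Set.mem_iUnion₂.2 ⟨t', ht', hw⟩, hdw⟩

end SemiIntervalFamilies

/-- For every `n ≥ 1`, the family of `n`-th powers of a family of semiintervals is again
a family of semiintervals; moreover, if the family is monotone then so is the family of
`n`-th powers. -/
theorem famPow_isSemiIntervalFamily {D : Type*} [LinearOrder D] (S : D → Set D)
    (hS : IsSemiIntervalFamily S) :
    (∀ n : ℕ, 1 ≤ n → IsSemiIntervalFamily (famPow S n)) ∧
    (IsMonotoneFamily S → ∀ n : ℕ, 1 ≤ n → IsMonotoneFamily (famPow S n)) :=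
  ⟨fun n _ => hS.famPow n, fun hM n _ => hM.famPow n⟩
end

section
/- Let (D',<) be a linear order, D ⊆ D', and let S = (S_x | x ∈ D) be a family of semiintervals of (D,<). Define R_x = conv_{D'}(S_x) for x ∈ D and R_x = {x} for x ∈ D' \ D. Then R = (R_x | x ∈ D') is a family of semiintervals of (D',<), and for all n ≥ 1: R_x^n = conv_{D'}(S_x^n) and R_x^n ∩ D = S_x^n whenever x ∈ D, while R_x^n = {x} whenever x ∈ D' \ D. Moreover, for every x ∈ D', R_x is an R-shift if and only if x ∈ D and S_x is an S-shift. -/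
open SemiIntervalFamilies

namespace SemiIntervalFamilies

theorem subset_conv {α : Type*} [LinearOrder α] (X : Set α) : X ⊆ conv X :=
  fun d hd => ⟨d, hd, d, hd, le_rfl, le_rfl⟩

theorem conv_mono {α : Type*} [LinearOrder α] {X Y : Set α} (h : X ⊆ Y) : conv X ⊆ conv Y :=
  fun _ ⟨a, ha, b, hb, had, hdb⟩ => ⟨a, h ha, b, h hb, had, hdb⟩

theorem mem_famPow_succ {α : Type*} {S : α → Set α} {n : ℕ} {x y : α} :
    y ∈ famPow S (n + 1) x ↔ ∃ t ∈ famPow S n x, y ∈ S t := by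
  simp [famPow]

theorem famPow_eq_singleton {α : Type*} {S : α → Set α} {x : α} (h : S x = {x}) (n : ℕ) :
    famPow S n x = {x} := by
  induction n with
  | zero => rfl
  | succ n ih => simp [famPow, ih, h]

section Powers

variable {α : Type*} {D : Set α} {S : α → Set α} {x : α}

theorem famPow_subset (hsub : ∀ x ∈ D, S x ⊆ D) (hx : x ∈ D) (n : ℕ) : famPow S n x ⊆ D := by
  induction n with
  | zero => simpa [famPow] using hx
  | succ n ih =>
    intro y hy
    obtain ⟨t, ht, hyt⟩ := mem_famPow_succ.1 hy
    exact hsub t (ih ht) hyt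

theorem famPow_subset_succ (hsub : ∀ x ∈ D, S x ⊆ D) (hmem : ∀ x ∈ D, x ∈ S x) (hx : x ∈ D)
    (n : ℕ) : famPow S n x ⊆ famPow S (n + 1) x :=
  fun y hy => mem_famPow_succ.2 ⟨y, hy, hmem y (famPow_subset hsub hx n hy)⟩

theorem self_mem_famPow (hsub : ∀ x ∈ D, S x ⊆ D) (hmem : ∀ x ∈ D, x ∈ S x) (hx : x ∈ D)
    (n : ℕ) : x ∈ famPow S n x := by
  induction n with
  | zero => exact rfl
  | succ n ih => exact famPow_subset_succ hsub hmem hx n ih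

variable [LinearOrder α]

theorem le_of_mem_famPow (hsub : ∀ x ∈ D, S x ⊆ D) (hmin : ∀ x ∈ D, ∀ y ∈ S x, x ≤ y)
    (hx : x ∈ D) (n : ℕ) {y : α} (hy : y ∈ famPow S n x) : x ≤ y := by
  induction n generalizing y with
  | zero => exact (Set.mem_singleton_iff.1 hy).ge
  | succ n ih =>
    obtain ⟨t, ht, hyt⟩ := mem_famPow_succ.1 hy
    exact (ih ht).trans (hmin t (famPow_subset hsub hx n ht) y hyt)

theorem mem_famPow_of_le (hsub : ∀ x ∈ D, S x ⊆ D)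
    (hconv : ∀ x ∈ D, ∀ a ∈ S x, ∀ b ∈ S x, ∀ c ∈ D, a ≤ c → c ≤ b → c ∈ S x)
    (hmem : ∀ x ∈ D, x ∈ S x) (hx : x ∈ D) (n : ℕ) {b c : α} (hb : b ∈ famPow S n x)
    (hc : c ∈ D) (hxc : x ≤ c) (hcb : c ≤ b) : c ∈ famPow S n x := by
  induction n generalizing b with
  | zero =>
    obtain rfl := Set.mem_singleton_iff.1 hb
    exact le_antisymm hcb hxc
  | succ n ih =>
    obtain ⟨t, ht, hbt⟩ := mem_famPow_succ.1 hb
    rcases le_total c t with hct | htc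
    · exact famPow_subset_succ hsub hmem hx n (ih ht hct)
    · have htD := famPow_subset hsub hx n ht
      exact mem_famPow_succ.2 ⟨t, ht, hconv t htD t (hmem t htD) b hbt c hc htc hcb⟩

theorem conv_famPow_inter (hsub : ∀ x ∈ D, S x ⊆ D)
    (hconv : ∀ x ∈ D, ∀ a ∈ S x, ∀ b ∈ S x, ∀ c ∈ D, a ≤ c → c ≤ b → c ∈ S x)
    (hmem : ∀ x ∈ D, x ∈ S x) (hmin : ∀ x ∈ D, ∀ y ∈ S x, x ≤ y) (hx : x ∈ D) (n : ℕ) :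
    conv (famPow S n x) ∩ D = famPow S n x := by
  refine Set.Subset.antisymm ?_ fun y hy => ⟨subset_conv _ hy, famPow_subset hsub hx n hy⟩
  rintro d ⟨⟨a, ha, b, hb, had, hdb⟩, hd⟩
  exact mem_famPow_of_le hsub hconv hmem hx n hb hd
    ((le_of_mem_famPow hsub hmin hx n ha).trans had) hdb

theorem famPow_eq_conv (hsub : ∀ x ∈ D, S x ⊆ D)
    (hconv : ∀ x ∈ D, ∀ a ∈ S x, ∀ b ∈ S x, ∀ c ∈ D, a ≤ c → c ≤ b → c ∈ S x)
    (hmem : ∀ x ∈ D, x ∈ S x) (hmin : ∀ x ∈ D, ∀ y ∈ S x, x ≤ y) {R : α → Set α}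
    (hR₁ : ∀ x ∈ D, R x = conv (S x)) (hR₂ : ∀ x ∉ D, R x = {x}) (hx : x ∈ D) (n : ℕ) :
    famPow R n x = conv (famPow S n x) := by
  induction n with
  | zero =>
    refine Set.Subset.antisymm (subset_conv _) ?_
    rintro d ⟨a, rfl, b, rfl, had, hdb⟩
    exact le_antisymm hdb had
  | succ n ih =>
    ext d
    rw [mem_famPow_succ, ih]
    constructor
    · rintro ⟨t, ht, hdt⟩
      by_cases htD : t ∈ D
      · rw [hR₁ t htD] at hdt
        have htS : t ∈ famPow S n x :=
          (conv_famPow_inter hsub hconv hmem hmin hx n).subset ⟨ht, htD⟩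
        exact conv_mono (fun y hy => mem_famPow_succ.2 ⟨t, htS, hy⟩) hdt
      · rw [hR₂ t htD, Set.mem_singleton_iff] at hdt
        exact hdt ▸ conv_mono (famPow_subset_succ hsub hmem hx n) ht
    · rintro ⟨a, ha, b, hb, had, hdb⟩
      obtain ⟨t, ht, hbt⟩ := mem_famPow_succ.1 hb
      have htD := famPow_subset hsub hx n ht
      rcases le_total d t with hdt | htd
      · refine ⟨d, ⟨x, self_mem_famPow hsub hmem hx n, t, ht,
          (le_of_mem_famPow hsub hmin hx (n + 1) ha).trans had, hdt⟩, ?_⟩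
        by_cases hd : d ∈ D
        · rw [hR₁ d hd]
          exact subset_conv _ (hmem d hd)
        · rw [hR₂ d hd]
          exact rfl
      · refine ⟨t, subset_conv _ ht, ?_⟩
        rw [hR₁ t htD]
        exact ⟨t, hmem t htD, b, hbt, htd, hdb⟩

end Powers

end SemiIntervalFamilies

/-- Extending a family of semiintervals on a subset `D` of a linear order `D'` by taking
convex hulls on `D` and singletons off `D`: the result is a family of semiintervals of `D'`
whose powers are the convex hulls of the powers of the original family (resp. singletons),
which induce the original powers on `D`, and whose shifts are exactly the shifts of the
original family. -/
theorem extend_semiIntervalFamily_by_convexHulls {D' : Type*} [LinearOrder D'] (D : Set D')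
    (S : D' → Set D')
    (hsub : ∀ x ∈ D, S x ⊆ D)
    (hconv : ∀ x ∈ D, ∀ a ∈ S x, ∀ b ∈ S x, ∀ c ∈ D, a ≤ c → c ≤ b → c ∈ S x)
    (hmem : ∀ x ∈ D, x ∈ S x)
    (hmin : ∀ x ∈ D, ∀ y ∈ S x, x ≤ y)
    (R : D' → Set D')
    (hR₁ : ∀ x ∈ D, R x = conv (S x))
    (hR₂ : ∀ x ∉ D, R x = {x}) :
    IsSemiIntervalFamily R ∧
    (∀ x ∈ D, ∀ n : ℕ, 1 ≤ n →
      famPow R n x = conv (famPow S n x) ∧ famPow R n x ∩ D = famPow S n x) ∧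
    (∀ x ∉ D, ∀ n : ℕ, 1 ≤ n → famPow R n x = {x}) ∧
    (∀ x : D', IsShift R x ↔ x ∈ D ∧ IsShift S x) := by
  have hpow : ∀ x ∈ D, ∀ n, famPow R n x = conv (famPow S n x) := fun x hx n =>
    famPow_eq_conv hsub hconv hmem hmin hR₁ hR₂ hx n
  have hinter : ∀ x ∈ D, ∀ n, conv (famPow S n x) ∩ D = famPow S n x := fun x hx n =>
    conv_famPow_inter hsub hconv hmem hmin hx n
  refine ⟨fun x => ?_, fun x hx n _ => ⟨hpow x hx n, by rw [hpow x hx n, hinter x hx n]⟩,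
    fun x hx n _ => famPow_eq_singleton (hR₂ x hx) n, fun x => ?_⟩
  · by_cases hx : x ∈ D
    · rw [hR₁ x hx]
      refine ⟨?_, subset_conv _ (hmem x hx), ?_⟩
      · rintro a ⟨p, hp, _, _, hpa, _⟩ b ⟨_, _, q, hq, _, hbq⟩ c hac hcb
        exact ⟨p, hp, q, hq, hpa.trans hac, hcb.trans hbq⟩
      · rintro y ⟨p, hp, _, _, hpy, _⟩
        exact (hmin x hx p hp).trans hpy
    · rw [hR₂ x hx]
      refine ⟨?_, rfl, ?_⟩
      · rintro a rfl b rfl c hac hcb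
        exact le_antisymm hcb hac
      · rintro y rfl
        exact le_rfl
  · by_cases hx : x ∈ D
    · have hiff : ∀ m n, conv (famPow S m x) ⊆ conv (famPow S n x) ↔
          famPow S m x ⊆ famPow S n x := fun m n =>
        ⟨fun h => by
          rw [← hinter x hx m, ← hinter x hx n]
          exact Set.inter_subset_inter_left D h, conv_mono⟩
      simp only [IsShift, hx, true_and, hpow x hx, ssubset_iff_subset_not_subset, hiff]
    · refine ⟨fun h => ?_, fun h => absurd h.1 hx⟩
      have h₁ := h 1 le_rfl
      rw [famPow_eq_singleton (hR₂ x hx), famPow_eq_singleton (hR₂ x hx)] at h₁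
      exact absurd h₁ (ssubset_irrefl _)
end

section
/- Let S = (S_x | x ∈ D) be a monotone family of semiintervals of a linear order (D,<), let k ≥ 2, and let (a_n)_{n ∈ ℕ} be a sequence in D such that for every n, a_{n+1} ∈ S_{a_n}^k and every element of S_{a_n} is strictly less than a_{n+1}. Then S_{a_0} is a shift: the sequence of powers (S_{a_0}^n)_{n ≥ 1} is strictly increasing under inclusion. -/
open SemiIntervalFamilies

namespace SemiIntervalFamilies

theorem famPow_subset_of_closed {D : Type*} {S : D → Set D} {P : Set D}
    (hP : ∀ t ∈ P, S t ⊆ P) {x : D} (hx : x ∈ P) (m : ℕ) : famPow S m x ⊆ P := by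
  induction m with
  | zero => exact Set.singleton_subset_iff.mpr hx
  | succ m ih => exact Set.iUnion₂_subset fun t ht => hP t (ih ht)

theorem famPow_subset_succ_s7 {D : Type*} [LinearOrder D] {S : D → Set D}
    (hS : IsSemiIntervalFamily S) (x : D) (n : ℕ) : famPow S n x ⊆ famPow S (n + 1) x :=
  fun y hy => Set.mem_iUnion₂.mpr ⟨y, hy, (hS y).2.1⟩

/-- A sequence with `S (a n) < a (n + 1)` outgrows the powers of `S` at `a 0`. -/
theorem lt_of_mem_famPow_succ {D : Type*} [LinearOrder D] {S : D → Set D}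
    (hmono : IsMonotoneFamily S) {a : ℕ → D}
    (ha : ∀ n, ∀ y ∈ S (a n), y < a (n + 1)) (m : ℕ) :
    ∀ y ∈ famPow S (m + 1) (a 0), y < a (m + 1) := by
  have step : ∀ n t y, t ≤ a n → y ∈ S t → y < a (n + 1) := fun n t y ht hy => by
    obtain ⟨z, hz, hyz⟩ := hmono t (a n) ht ⟨y, hy, le_rfl⟩
    exact hyz.trans_lt (ha n z hz)
  induction m with
  | zero =>
    intro y hy
    obtain ⟨t, ht, hyt⟩ := Set.mem_iUnion₂.mp hy
    exact step 0 t y (Set.mem_singleton_iff.mp ht).le hyt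
  | succ m ih =>
    intro y hy
    obtain ⟨t, ht, hyt⟩ := Set.mem_iUnion₂.mp hy
    exact step (m + 1) t y (ih t ht).le hyt

end SemiIntervalFamilies

/-- If in a monotone family of semiintervals there is a sequence `(a_n)` with
`a_{n+1} ∈ S_{a_n}^k` (`k ≥ 2`) and `S_{a_n} < a_{n+1}` for all `n`, then
`S_{a_0}` is a shift. -/
theorem isShift_of_escaping_sequence {D : Type*} [LinearOrder D] (S : D → Set D)
    (hS : IsSemiIntervalFamily S) (hmono : IsMonotoneFamily S)
    (k : ℕ) (hk : 2 ≤ k) (a : ℕ → D)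
    (hseq : ∀ n : ℕ, a (n + 1) ∈ famPow S k (a n) ∧ ∀ y ∈ S (a n), y < a (n + 1)) :
    IsShift S (a 0) := by
  intro n hn
  refine ⟨famPow_subset_succ_s7 hS _ n, fun hle => ?_⟩
  have hclosed : ∀ t ∈ famPow S n (a 0), S t ⊆ famPow S n (a 0) := fun t ht y hy =>
    hle (Set.mem_iUnion₂.mpr ⟨t, ht, hy⟩)
  have hzero : ∀ m, a 0 ∈ famPow S m (a 0) := fun m => by
    induction m with
    | zero => exact Set.mem_singleton _
    | succ m ih => exact famPow_subset_succ_s7 hS _ m ih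
  have hmem : ∀ i, a i ∈ famPow S n (a 0) := fun i => by
    induction i with
    | zero => exact hzero n
    | succ i ih => exact famPow_subset_of_closed hclosed ih k (hseq i).1
  obtain ⟨m, rfl⟩ := Nat.exists_eq_add_of_le' hn
  exact lt_irrefl _ (lt_of_mem_famPow_succ hmono (fun n => (hseq n).2) m _ (hmem (m + 1)))
end

section
/- Let S = (S_x | x ∈ D) be a family of semiintervals of a linear order (D,<), let a ∈ D and k ≥ 1, and suppose S_a^k ≠ S_a. Then S_a is a proper initial part of S_a^k: S_a ⊆ S_a^k, every element of S_a^k \ S_a is strictly greater than every element of S_a, and in particular there exists y ∈ S_a^k such that every element of S_a is strictly less than y. -/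
open SemiIntervalFamilies

namespace SemiIntervalFamilies

theorem le_of_mem_famPow_s9 {D : Type*} [LinearOrder D] {S : D → Set D}
    (hS : IsSemiIntervalFamily S) {a : D} {n : ℕ} {z : D} (hz : z ∈ famPow S n a) : a ≤ z := by
  induction n generalizing z with
  | zero => exact (Set.mem_singleton_iff.mp hz).ge
  | succ n ih =>
    obtain ⟨t, ht, hzt⟩ := Set.mem_iUnion₂.mp hz
    exact (ih ht).trans ((hS t).2.2 z hzt)

theorem famPow_one {D : Type*} (S : D → Set D) (a : D) : famPow S 1 a = S a := by
  simp [famPow]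

theorem monotone_famPow {D : Type*} [LinearOrder D] {S : D → Set D}
    (hS : IsSemiIntervalFamily S) (a : D) : Monotone fun n ↦ famPow S n a :=
  monotone_nat_of_le_succ fun _ z hz ↦ Set.mem_iUnion₂.mpr ⟨z, hz, (hS z).2.1⟩

end SemiIntervalFamilies

/-- If `S_a^k ≠ S_a` for some `k ≥ 1`, then `S_a` is a proper initial part of `S_a^k`:
`S_a ⊆ S_a^k`, every element of `S_a^k \ S_a` is strictly above all of `S_a`, and in
particular some element of `S_a^k` is strictly above all of `S_a`. -/
theorem semiInterval_proper_initial_part_of_pow_ne {D : Type*} [LinearOrder D]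
    (S : D → Set D) (hS : IsSemiIntervalFamily S) (a : D) (k : ℕ) (hk : 1 ≤ k)
    (hne : famPow S k a ≠ S a) :
    S a ⊆ famPow S k a ∧
    (∀ z ∈ famPow S k a, z ∉ S a → ∀ w ∈ S a, w < z) ∧
    (∃ y ∈ famPow S k a, ∀ w ∈ S a, w < y) := by
  have hsub : S a ⊆ famPow S k a := famPow_one S a ▸ monotone_famPow hS a hk
  have habove : ∀ z ∈ famPow S k a, z ∉ S a → ∀ w ∈ S a, w < z := by
    intro z hz hza w hw
    by_contra! hzw
    exact hza ((hS a).1 a (hS a).2.1 w hw z (le_of_mem_famPow_s9 hS hz) hzw)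
  obtain ⟨y, hy, hya⟩ := Set.exists_of_ssubset (hsub.ssubset_of_ne hne.symm)
  exact ⟨hsub, habove, y, hy, habove y hy hya⟩
end
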